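/- Let x = (x1, …, xn) ∈ ℝ^n have a unique maximal entry, i.e. there is an index k with x_k > x_j for all j ≠ k. Then as the temperature T tends to +∞, the softmax-with-temperature output σ1(x,T) converges to the one-hot vector e_k: σ1(x,T)_k → 1 and σ1(x,T)_j → 0 for every j ≠ k. -/

import Mathlib

open Real Filter

/-- Softmax with temperature `T`: the `i`-th entry is `exp(T·xᵢ) / Σⱼ exp(T·xⱼ)`. -/
noncomputable def softmaxT {n : ℕ} (T : ℝ) (x : Fin n → ℝ) (i : Fin n) : ℝ :=
  Real.exp (T * x i) / ∑ j, Real.exp (T * x j)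

/-- Softmax is invariant under subtracting a constant from every entry. -/
lemma softmaxT_eq_sub {n : ℕ} (T : ℝ) (x : Fin n → ℝ) (c : ℝ) (i : Fin n) :
    softmaxT T x i = Real.exp (T * (x i - c)) / ∑ j, Real.exp (T * (x j - c)) := by
  simp only [softmaxT, mul_sub, Real.exp_sub, ← Finset.sum_div]
  rw [div_div_div_cancel_right₀ (Real.exp_ne_zero _)]

lemma tendsto_exp_mul_sub {n : ℕ} {x : Fin n → ℝ} {k : Fin n}
    (hk : ∀ j, j ≠ k → x j < x k) (j : Fin n) :
    Tendsto (fun T : ℝ => Real.exp (T * (x j - x k))) atTop (nhds (if j = k then 1 else 0)) := by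
  split_ifs with h
  · simp [h]
  · exact Real.tendsto_exp_atBot.comp
      (tendsto_id.atTop_mul_const_of_neg (sub_neg.2 (hk j h)))

lemma tendsto_softmaxT {n : ℕ} {x : Fin n → ℝ} {k : Fin n}
    (hk : ∀ j, j ≠ k → x j < x k) (i : Fin n) :
    Tendsto (fun T : ℝ => softmaxT T x i) atTop (nhds (if i = k then 1 else 0)) := by
  have hsum : Tendsto (fun T : ℝ => ∑ j, Real.exp (T * (x j - x k))) atTop (nhds 1) := by
    simpa using tendsto_finsetSum Finset.univ fun j _ => tendsto_exp_mul_sub hk j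
  simpa only [softmaxT_eq_sub _ x (x k), div_one, Pi.div_def] using
    (tendsto_exp_mul_sub hk i).div hsum one_ne_zero

/-- If `x ∈ ℝⁿ` has a unique maximal entry `x_k`, then as the temperature `T → +∞` the
softmax output converges to the one-hot vector `e_k`: the `k`-th entry tends to `1` and
every other entry tends to `0`. -/
theorem softmaxT_tendsto_one_hot (n : ℕ) (x : Fin n → ℝ) (k : Fin n)
    (hk : ∀ j, j ≠ k → x j < x k) :
    Tendsto (fun T : ℝ => softmaxT T x k) atTop (nhds 1) ∧
      ∀ j, j ≠ k → Tendsto (fun T : ℝ => softmaxT T x j) atTop (nhds 0) := by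
  exact ⟨by simpa using tendsto_softmaxT hk k,
    fun j hj => by simpa [hj] using tendsto_softmaxT hk j⟩
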